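/- For all nonnegative integers k, l, m, n, the Laguerre 2D polynomials are orthogonal with Gaussian weight over the plane: ∫_{ℝ²} exp(-(x² + y²)) · conj(L_{k,l}(x + i y, x - i y)) · L_{m,n}(x + i y, x - i y) dx dy = π · m! · n! if k = m and l = n, and the integral equals 0 otherwise. -/

import Mathlib

open Finset MeasureTheory

/-- The Laguerre 2D polynomials. -/
noncomputable def L2D (m n : ℕ) (z z' : ℂ) : ℂ :=
  ∑ j ∈ Finset.range (min m n + 1),
    (-1 : ℂ) ^ j * (Nat.factorial m : ℂ) * (Nat.factorial n : ℂ) /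
      ((Nat.factorial j : ℂ) * (Nat.factorial (m - j) : ℂ) * (Nat.factorial (n - j) : ℂ)) *
      z ^ (m - j) * z' ^ (n - j)

open Complex in
/-- The angular integral `∫ e^{i(a-b)θ} dθ` over a full period. -/
lemma integral_cexp_mul_I_pow_mul (a b : ℕ) :
    ∫ θ in Set.Ioo (-Real.pi) Real.pi, cexp (θ * I) ^ a * cexp (-(θ * I)) ^ b =
      if a = b then 2 * (Real.pi : ℂ) else 0 := by
  have hexp (θ : ℝ) : cexp (θ * I) ^ a * cexp (-(θ * I)) ^ b =
      cexp ((((a : ℂ) - b) * I) * θ) := by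
    rw [← Complex.exp_nat_mul, ← Complex.exp_nat_mul, ← Complex.exp_add]
    ring_nf
  simp_rw [hexp]
  rw [← integral_Ioc_eq_integral_Ioo,
    ← intervalIntegral.integral_of_le (by linarith [Real.pi_pos])]
  split_ifs with hab
  · subst hab
    simp
    ring
  · have hne : ((a : ℂ) - b) * I ≠ 0 :=
      mul_ne_zero (sub_ne_zero.2 (by exact_mod_cast hab)) I_ne_zero
    rw [integral_exp_mul_complex hne, div_eq_zero_iff, sub_eq_zero]
    left
    rw [Complex.exp_eq_exp_iff_exists_int]
    exact ⟨(a : ℤ) - b, by push_cast; ring⟩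

/-- The radial Gaussian moments. -/
lemma integral_Ioi_pow_mul_exp_neg_sq (a : ℕ) :
    ∫ r in Set.Ioi (0 : ℝ), r ^ (2 * a + 1) * Real.exp (-r ^ 2) = a.factorial / 2 := by
  have h := integral_rpow_mul_exp_neg_rpow (p := 2) (q := ((2 * a + 1 : ℕ) : ℝ)) two_pos
    (by have : (0 : ℝ) ≤ ((2 * a + 1 : ℕ) : ℝ) := Nat.cast_nonneg _
        linarith)
  simp only [Real.rpow_natCast, Real.rpow_two] at h
  rw [h, show (((2 * a + 1 : ℕ) : ℝ) + 1) / 2 = a + 1 by push_cast; ring,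
    Real.Gamma_nat_eq_factorial]
  ring

open Complex in
/-- The Gaussian moments of the plane in complex coordinates. -/
lemma integral_gaussian_mul_pow_mul_conj_pow (a b : ℕ) :
    ∫ p : ℝ × ℝ, (Real.exp (-(p.1 ^ 2 + p.2 ^ 2)) : ℂ) *
        (((p.1 : ℂ) + (p.2 : ℂ) * I) ^ a * ((p.1 : ℂ) - (p.2 : ℂ) * I) ^ b) =
      if a = b then (Real.pi : ℂ) * (a.factorial : ℂ) else 0 := by
  rw [← integral_comp_polarCoord_symm, polarCoord_target]
  have hpolar (p : ℝ × ℝ) : p.1 • ((Real.exp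
        (-((polarCoord.symm p).1 ^ 2 + (polarCoord.symm p).2 ^ 2)) : ℂ) *
        ((((polarCoord.symm p).1 : ℂ) + ((polarCoord.symm p).2 : ℂ) * I) ^ a *
          (((polarCoord.symm p).1 : ℂ) - ((polarCoord.symm p).2 : ℂ) * I) ^ b)) =
      ((p.1 ^ (a + b + 1) * Real.exp (-p.1 ^ 2) : ℝ) : ℂ) *
        (cexp (p.2 * I) ^ a * cexp (-(p.2 * I)) ^ b) := by
    have hnorm : (p.1 * Real.cos p.2) ^ 2 + (p.1 * Real.sin p.2) ^ 2 = p.1 ^ 2 := by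
      linear_combination p.1 ^ 2 * Real.sin_sq_add_cos_sq p.2
    have hz : ((p.1 * Real.cos p.2 : ℝ) : ℂ) + ((p.1 * Real.sin p.2 : ℝ) : ℂ) * I =
        p.1 * cexp (p.2 * I) := by
      rw [Complex.exp_mul_I]; push_cast; ring
    have hz' : ((p.1 * Real.cos p.2 : ℝ) : ℂ) - ((p.1 * Real.sin p.2 : ℝ) : ℂ) * I =
        p.1 * cexp (-(p.2 * I)) := by
      rw [← neg_mul, Complex.exp_mul_I, Complex.cos_neg, Complex.sin_neg]; push_cast; ring
    simp only [polarCoord_symm_apply]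
    rw [hnorm, hz, hz', Complex.real_smul]
    push_cast
    ring
  simp_rw [hpolar]
  rw [Measure.volume_eq_prod, setIntegral_prod_mul
      (fun r : ℝ => ((r ^ (a + b + 1) * Real.exp (-r ^ 2) : ℝ) : ℂ))
      (fun θ : ℝ => cexp (θ * I) ^ a * cexp (-(θ * I)) ^ b),
    integral_cexp_mul_I_pow_mul]
  split_ifs with hab
  · subst hab
    rw [integral_complex_ofReal, ← two_mul, integral_Ioi_pow_mul_exp_neg_sq]
    push_cast
    ring
  · simp

open Complex in
lemma integrable_gaussian_mul_pow_mul_conj_pow (a b : ℕ) :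
    Integrable fun p : ℝ × ℝ => (Real.exp (-(p.1 ^ 2 + p.2 ^ 2)) : ℂ) *
      (((p.1 : ℂ) + (p.2 : ℂ) * I) ^ a * ((p.1 : ℂ) - (p.2 : ℂ) * I) ^ b) := by
  have hdiag (c : ℕ) : Integrable fun p : ℝ × ℝ => (Real.exp (-(p.1 ^ 2 + p.2 ^ 2)) : ℂ) *
      (((p.1 : ℂ) + (p.2 : ℂ) * I) ^ c * ((p.1 : ℂ) - (p.2 : ℂ) * I) ^ c) := by
    apply Integrable.of_integral_ne_zero
    rw [integral_gaussian_mul_pow_mul_conj_pow, if_pos rfl]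
    exact mul_ne_zero (by exact_mod_cast Real.pi_ne_zero)
      (by exact_mod_cast c.factorial_ne_zero)
  refine ((hdiag a).norm.add (hdiag b).norm).mono'
    (Continuous.aestronglyMeasurable (by fun_prop)) (Filter.Eventually.of_forall fun p => ?_)
  have hconj : ‖(p.1 : ℂ) - (p.2 : ℂ) * I‖ = ‖(p.1 : ℂ) + (p.2 : ℂ) * I‖ := by
    rw [← Complex.norm_conj]
    simp
  simp only [Pi.add_apply, norm_mul, norm_pow, hconj]
  rw [← mul_add]
  refine mul_le_mul_of_nonneg_left ?_ (norm_nonneg _)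
  set r := ‖(p.1 : ℂ) + (p.2 : ℂ) * I‖
  nlinarith [sq_nonneg (r ^ a - r ^ b), sq_nonneg (r ^ a), sq_nonneg (r ^ b)]

lemma L2D_swap (m n : ℕ) (z z' : ℂ) : L2D m n z z' = L2D n m z' z := by
  unfold L2D
  rw [min_comm]
  refine Finset.sum_congr rfl fun j _ => ?_
  ring

lemma conj_L2D (m n : ℕ) (z z' : ℂ) :
    (starRingEnd ℂ) (L2D m n z z') = L2D m n ((starRingEnd ℂ) z) ((starRingEnd ℂ) z') := by
  simp [L2D, map_sum]

/-- The `n`-th finite difference of a binomial coefficient of lower index at most `n`. -/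
lemma sum_neg_one_pow_mul_choose_mul_choose {a n : ℕ} (han : a ≤ n) (b : ℕ) :
    ∑ j ∈ Finset.range (n + 1), (-1 : ℤ) ^ j * n.choose j * (b + n - j).choose a =
      if a = n then 1 else 0 := by
  have hdiff : (fwdDiff 1)^[n] (fun x : ℕ => (x.choose a : ℤ)) b = if a = n then 1 else 0 := by
    obtain ⟨d, rfl⟩ := Nat.exists_eq_add_of_le han
    have hconst : (fwdDiff 1)^[a] (fun x : ℕ => (x.choose a : ℤ)) = fun _ => 1 := by
      simpa using fwdDiff_iter_choose 0 a
    rw [add_comm, Function.iterate_add_apply, hconst]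
    cases d with
    | zero => simp
    | succ d =>
      rw [Function.iterate_succ_apply, fwdDiff_const]
      simp [fwdDiff_iter_eq_sum_shift]
  rw [← hdiff, fwdDiff_iter_eq_sum_shift, ← Finset.sum_range_reflect]
  refine Finset.sum_congr rfl fun j hj => ?_
  have hjn : j ≤ n := Nat.lt_succ_iff.1 (Finset.mem_range.1 hj)
  have h1 : n + 1 - 1 - j = n - j := by omega
  have h2 : b + n - (n - j) = b + j := by omega
  rw [h1, h2, Nat.choose_symm hjn]
  simp

/-- Each term of the integral of a monomial against `L2D m n` is an alternating binomial term. -/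
lemma L2D_coeff_mul_factorial {a b m n j : ℕ} (h : a + m = b + n) (hjm : j ≤ m) (hjn : j ≤ n) :
    (-1 : ℂ) ^ j * (m.factorial : ℂ) * (n.factorial : ℂ) /
        ((j.factorial : ℂ) * ((m - j).factorial : ℂ) * ((n - j).factorial : ℂ)) *
        ((a + (m - j)).factorial : ℂ) =
      (m.factorial : ℂ) * (a.factorial : ℂ) *
        (((-1 : ℤ) ^ j * n.choose j * (b + n - j).choose a : ℤ) : ℂ) := by
  have hsum : b + n - j = a + (m - j) := by omega
  have h1 : (n.choose j : ℂ) * (j.factorial : ℂ) * ((n - j).factorial : ℂ) = n.factorial := by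
    exact_mod_cast Nat.choose_mul_factorial_mul_factorial hjn
  have h2 : ((a + (m - j)).choose a : ℂ) * (a.factorial : ℂ) * ((m - j).factorial : ℂ) =
      (a + (m - j)).factorial := by
    have := Nat.choose_mul_factorial_mul_factorial (Nat.le_add_right a (m - j))
    rw [Nat.add_sub_cancel_left] at this
    exact_mod_cast this
  have hj : (j.factorial : ℂ) ≠ 0 := by exact_mod_cast j.factorial_ne_zero
  have hm : ((m - j).factorial : ℂ) ≠ 0 := by exact_mod_cast (m - j).factorial_ne_zero
  have hn : ((n - j).factorial : ℂ) ≠ 0 := by exact_mod_cast (n - j).factorial_ne_zero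
  rw [hsum, ← h1, ← h2]
  push_cast
  field_simp

lemma gaussian_mul_monomial_mul_L2D (a b m n : ℕ) (w z z' : ℂ) :
    w * (z ^ a * z' ^ b) * L2D m n z z' = ∑ j ∈ Finset.range (min m n + 1),
      (-1 : ℂ) ^ j * (m.factorial : ℂ) * (n.factorial : ℂ) /
        ((j.factorial : ℂ) * ((m - j).factorial : ℂ) * ((n - j).factorial : ℂ)) *
        (w * (z ^ (a + (m - j)) * z' ^ (b + (n - j)))) := by
  rw [L2D, Finset.mul_sum]
  refine Finset.sum_congr rfl fun j _ => ?_
  ring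

open Complex in
lemma integrable_gaussian_mul_monomial_mul_L2D (a b m n : ℕ) :
    Integrable fun p : ℝ × ℝ => (Real.exp (-(p.1 ^ 2 + p.2 ^ 2)) : ℂ) *
      (((p.1 : ℂ) + (p.2 : ℂ) * I) ^ a * ((p.1 : ℂ) - (p.2 : ℂ) * I) ^ b) *
      L2D m n ((p.1 : ℂ) + (p.2 : ℂ) * I) ((p.1 : ℂ) - (p.2 : ℂ) * I) := by
  simp_rw [gaussian_mul_monomial_mul_L2D]
  exact integrable_finsetSum _ fun j _ =>
    (integrable_gaussian_mul_pow_mul_conj_pow _ _).const_mul _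

open Complex in
/-- `L2D m n` is orthogonal to the monomials `z ^ a * conj z ^ b` with `a ≤ n` or `b ≤ m`,
other than `z ^ n * conj z ^ m`. -/
lemma integral_gaussian_mul_monomial_mul_L2D {a b m n : ℕ} (hab : a ≤ n ∨ b ≤ m) :
    ∫ p : ℝ × ℝ, (Real.exp (-(p.1 ^ 2 + p.2 ^ 2)) : ℂ) *
      (((p.1 : ℂ) + (p.2 : ℂ) * I) ^ a * ((p.1 : ℂ) - (p.2 : ℂ) * I) ^ b) *
      L2D m n ((p.1 : ℂ) + (p.2 : ℂ) * I) ((p.1 : ℂ) - (p.2 : ℂ) * I) =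
    if a = n ∧ b = m then (Real.pi : ℂ) * (m.factorial : ℂ) * (n.factorial : ℂ) else 0 := by
  simp_rw [gaussian_mul_monomial_mul_L2D]
  rw [integral_finsetSum _ fun j _ =>
    (integrable_gaussian_mul_pow_mul_conj_pow _ _).const_mul _]
  simp_rw [integral_const_mul, integral_gaussian_mul_pow_mul_conj_pow]
  by_cases h : a + m = b + n
  · have han : a ≤ n := by omega
    have hterm : ∀ j ∈ Finset.range (min m n + 1),
        (-1 : ℂ) ^ j * (m.factorial : ℂ) * (n.factorial : ℂ) /
          ((j.factorial : ℂ) * ((m - j).factorial : ℂ) * ((n - j).factorial : ℂ)) *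
          (if a + (m - j) = b + (n - j) then
            (Real.pi : ℂ) * ((a + (m - j)).factorial : ℂ) else 0) =
        (Real.pi : ℂ) * (m.factorial : ℂ) * (a.factorial : ℂ) *
          (((-1 : ℤ) ^ j * n.choose j * (b + n - j).choose a : ℤ) : ℂ) := by
      intro j hj
      rw [Finset.mem_range] at hj
      rw [if_pos (by omega)]
      linear_combination
        (Real.pi : ℂ) * L2D_coeff_mul_factorial h (by omega : j ≤ m) (by omega : j ≤ n)
    have hrange : ∑ j ∈ Finset.range (min m n + 1),
        (-1 : ℤ) ^ j * n.choose j * (b + n - j).choose a = if a = n then 1 else 0 := by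
      rw [← sum_neg_one_pow_mul_choose_mul_choose han b]
      refine Finset.sum_subset (fun j hj => ?_) fun j hj hj' => ?_
      · rw [Finset.mem_range] at *
        omega
      · rw [Finset.mem_range] at *
        rw [Nat.choose_eq_zero_of_lt (by omega : b + n - j < a)]
        simp
    rw [Finset.sum_congr rfl hterm, ← Finset.mul_sum, ← Int.cast_sum, hrange]
    by_cases ha : a = n
    · rw [if_pos ha, if_pos ⟨ha, by omega⟩, ha]
      simp
    · rw [if_neg ha, if_neg fun h' => ha h'.1]
      simp
  · rw [if_neg (by omega)]
    refine Finset.sum_eq_zero fun j hj => ?_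
    rw [Finset.mem_range] at hj
    rw [if_neg (by omega), mul_zero]

open Complex in
/-- The orthogonality relations for products without conjugation, under an index restriction. -/
lemma integral_gaussian_mul_L2D_mul_L2D {k l m n : ℕ} (h : l ≤ n ∨ k ≤ m) :
    ∫ p : ℝ × ℝ, (Real.exp (-(p.1 ^ 2 + p.2 ^ 2)) : ℂ) *
      L2D l k ((p.1 : ℂ) + (p.2 : ℂ) * I) ((p.1 : ℂ) - (p.2 : ℂ) * I) *
      L2D m n ((p.1 : ℂ) + (p.2 : ℂ) * I) ((p.1 : ℂ) - (p.2 : ℂ) * I) =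
    if k = m ∧ l = n then (Real.pi : ℂ) * (m.factorial : ℂ) * (n.factorial : ℂ) else 0 := by
  have hexpand (w z z' v : ℂ) : w * L2D l k z z' * v = ∑ i ∈ Finset.range (min l k + 1),
      (-1 : ℂ) ^ i * (l.factorial : ℂ) * (k.factorial : ℂ) /
        ((i.factorial : ℂ) * ((l - i).factorial : ℂ) * ((k - i).factorial : ℂ)) *
        (w * (z ^ (l - i) * z' ^ (k - i)) * v) := by
    rw [L2D, Finset.mul_sum, Finset.sum_mul]
    refine Finset.sum_congr rfl fun i _ => ?_
    ring
  simp_rw [hexpand]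
  rw [integral_finsetSum _ fun i _ =>
    (integrable_gaussian_mul_monomial_mul_L2D _ _ _ _).const_mul _]
  simp_rw [integral_const_mul]
  rw [Finset.sum_eq_single 0]
  · rw [integral_gaussian_mul_monomial_mul_L2D (by omega)]
    have hl : (l.factorial : ℂ) ≠ 0 := by exact_mod_cast l.factorial_ne_zero
    have hk : (k.factorial : ℂ) ≠ 0 := by exact_mod_cast k.factorial_ne_zero
    simp [and_comm, hl, hk]
  · intro i hi hi0
    rw [Finset.mem_range] at hi
    rw [integral_gaussian_mul_monomial_mul_L2D (by omega), if_neg (by omega), mul_zero]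
  · simp

theorem L2D_orthogonality (k l m n : ℕ) :
    ∫ p : ℝ × ℝ,
      (Real.exp (-(p.1 ^ 2 + p.2 ^ 2)) : ℂ) *
        (starRingEnd ℂ)
          (L2D k l ((p.1 : ℂ) + (p.2 : ℂ) * Complex.I) ((p.1 : ℂ) - (p.2 : ℂ) * Complex.I)) *
        L2D m n ((p.1 : ℂ) + (p.2 : ℂ) * Complex.I) ((p.1 : ℂ) - (p.2 : ℂ) * Complex.I) =
      if k = m ∧ l = n then
        (Real.pi : ℂ) * (Nat.factorial m : ℂ) * (Nat.factorial n : ℂ)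
      else 0 := by
  have hconj (x y : ℝ) : (starRingEnd ℂ) (L2D k l (x + y * Complex.I) (x - y * Complex.I)) =
      L2D l k (x + y * Complex.I) (x - y * Complex.I) := by
    rw [conj_L2D, L2D_swap]
    simp [sub_eq_add_neg]
  simp_rw [hconj]
  by_cases h : l ≤ n ∨ k ≤ m
  · exact integral_gaussian_mul_L2D_mul_L2D h
  · simp_rw [mul_right_comm _ (L2D l k _ _)]
    rw [integral_gaussian_mul_L2D_mul_L2D (by omega), if_neg (by omega), if_neg (by omega)]
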